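/- Fix an integer d ≥ 13 and λ ∈ ℝ, and assume all the hypotheses of the preceding setting: Θ is a C² solution of the truncated equation with Θ(t) − e^t + (2d)^{-1}e^{3t} = O(e^{5t}), Θ'(t) − e^t = O(e^{3t}), Θ''(t) − e^t = O(e^{3t}) as t → −∞; for each b > 0, Ψ_b is a C² solution of (E_λ) with Ψ_b(t) − b e^t + (λ b + b³)(2d)^{-1}e^{3t} = O(e^{5t}) as t → −∞, differentiable in b with γ_b := ∂_b Ψ_b a C² solution of (M_{Ψ_b,λ}) satisfying γ_b(t) − e^t = O(e^{3t}) as t → −∞. Assume in addition there exists A₀ ≠ 0 such that Θ(t) − √(d−3) − A₀ e^{κ₊ t} = O(e^{κ₋ t} + e^{2κ₊ t}) as t → +∞. Set a₀ := 2/(2 + |κ₊|). Then for every a ∈ (0, a₀) and T > 0 there exist b_{T,a} > 0 and C_{T,a} > 0 such that for every b > b_{T,a}: |γ_b(T + (a−1)·log b) − A₀ κ₊ b^{aκ₊ − 1} e^{κ₊ T}| ≤ C_{T,a} · max{ b^{−2(1−a)−1}, b^{aκ₋ − 1}, b^{2aκ₊ − 1} }. -/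

import Mathlib

open Filter Asymptotics Topology Set

/-- The characteristic exponent `κ₋ = (-(d-4) - √(d²-16d+40))/2`. -/
noncomputable def kappam (d : ℤ) : ℝ :=
  (-((d : ℝ) - 4) - Real.sqrt ((d : ℝ) ^ 2 - 16 * (d : ℝ) + 40)) / 2

/-- The characteristic exponent `κ₊ = (-(d-4) + √(d²-16d+40))/2`. -/
noncomputable def kappap (d : ℤ) : ℝ :=
  (-((d : ℝ) - 4) + Real.sqrt ((d : ℝ) ^ 2 - 16 * (d : ℝ) + 40)) / 2

lemma kappa_facts (d : ℤ) (hd : 13 ≤ d) :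
    kappap d + kappam d = -((d:ℝ) - 4) ∧ kappap d * kappam d = 2 * ((d:ℝ) - 3) ∧
      kappam d < kappap d ∧ kappap d < -2 := by
  have hd' : (13:ℝ) ≤ (d:ℝ) := by exact_mod_cast hd
  have hpos : (0:ℝ) < (d:ℝ)^2 - 16 * (d:ℝ) + 40 := by nlinarith
  have hs := Real.sq_sqrt hpos.le
  have hs0 := Real.sqrt_pos.mpr hpos
  have hlt : Real.sqrt ((d:ℝ)^2 - 16 * (d:ℝ) + 40) < (d:ℝ) - 8 := by
    rw [Real.sqrt_lt' (by linarith)]; nlinarith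
  unfold kappap kappam
  refine ⟨by ring, by nlinarith, by linarith, by linarith⟩

/-- interpolation of the first derivative -/
lemma interp_deriv {U U1 U2 : ℝ → ℝ} {c ρ s : ℝ} (hc : 0 ≤ c)
    (h1 : ∀ x, HasDerivAt U (U1 x) x) (h2 : ∀ x, HasDerivAt U1 (U2 x) x)
    (hU : ∀ x ∈ Icc (s-1) s, |U x| ≤ ρ)
    (hh : ∀ x ∈ Icc (s-1) s, |U2 x + c * U1 x| ≤ ρ) :
    |U1 s| ≤ (3 + 2 * c) * ρ := by
  obtain ⟨ξ, hξ, hξe⟩ := exists_hasDerivAt_eq_slope U U1 (show s - 1 < s by linarith)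
    (fun x _ => (h1 x).continuousAt.continuousWithinAt) (fun x _ => h1 x)
  have e1 : U1 ξ = U s - U (s-1) := by rw [hξe]; ring_nf
  have hE : ∀ x, HasDerivAt (fun x => U1 x + c * U x) (U2 x + c * U1 x) x :=
    fun x => (h2 x).add ((h1 x).const_mul c)
  have hm := Convex.norm_image_sub_le_of_norm_hasDerivWithin_le (s := Icc (s-1) s)
    (fun x _ => (hE x).hasDerivWithinAt) (fun x hx => by simpa using hh x hx) (convex_Icc _ _)
    (show ξ ∈ Icc (s-1) s from ⟨hξ.1.le, hξ.2.le⟩) (show s ∈ Icc (s-1) s from ⟨by linarith, le_rfl⟩)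
  simp only [Real.norm_eq_abs] at hm
  have hξ' : |s - ξ| ≤ 1 := by rw [abs_le]; constructor <;> linarith [hξ.1, hξ.2]
  have a1 := hU s ⟨by linarith, le_rfl⟩
  have a2 := hU (s-1) ⟨le_rfl, by linarith⟩
  have a3 := hU ξ ⟨hξ.1.le, hξ.2.le⟩
  have hρ : 0 ≤ ρ := (abs_nonneg _).trans a1
  have hm2 : |U1 s + c * U s - (U1 ξ + c * U ξ)| ≤ ρ := hm.trans (by nlinarith)
  rw [abs_le] at *
  have b1 : c * U s ≤ c * ρ := by nlinarith
  have b2 : -(c*ρ) ≤ c * U s := by nlinarith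
  have b3 : c * U ξ ≤ c * ρ := by nlinarith
  have b4 : -(c*ρ) ≤ c * U ξ := by nlinarith
  constructor <;> nlinarith

/-- comparison -/
lemma comparison {V V1 : ℝ → ℝ} {k m θ A : ℝ} {I : Set ℝ} (hI : Convex ℝ I)
    (hV : ∀ s, HasDerivAt V (V1 s) s)
    (hle : ∀ s ∈ I, V1 s ≤ k * V s + A * Real.exp (m * s))
    (hA : 0 ≤ A) (hθ : 1 ≤ θ * (k - m)) :
    AntitoneOn (fun s => Real.exp (-k * s) * (V s + θ * A * Real.exp (m * s))) I := by
  have hd : ∀ s, HasDerivAt (fun s => Real.exp (-k * s) * (V s + θ * A * Real.exp (m * s)))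
      (Real.exp (-k * s) * (-k * 1) * (V s + θ * A * Real.exp (m * s)) +
        Real.exp (-k * s) * (V1 s + θ * A * (Real.exp (m * s) * (m * 1)))) s := by
    intro s
    exact ((((hasDerivAt_id s).const_mul (-k)).exp).mul
      ((hV s).add ((((hasDerivAt_id s).const_mul m).exp).const_mul (θ * A))))
  apply antitoneOn_of_deriv_nonpos hI
  · exact fun s _ => (hd s).continuousAt.continuousWithinAt
  · exact fun s _ => (hd s).differentiableAt.differentiableWithinAt
  · intro s hs
    rw [(hd s).deriv]
    have := hle s (interior_subset hs)
    have e := Real.exp_pos (-k * s)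
    have e2 := Real.exp_pos (m * s)
    have hA2 : 0 ≤ A * Real.exp (m * s) := by positivity
    have : V1 s - k * V s + θ * (m - k) * (A * Real.exp (m*s)) ≤ 0 := by nlinarith
    nlinarith

lemma exp_mul_nat (n : ℕ) (s : ℝ) : Real.exp (n * s) = Real.exp s ^ n := by
  rw [Real.exp_nat_mul]

/-- region 1 -/
lemma region1 {D : ℝ} (hD : 13 ≤ D) {U U1 U2 q f : ℝ → ℝ} {η s1 : ℝ} (hη : 0 ≤ η)
    (h1 : ∀ x, HasDerivAt U (U1 x) x) (h2 : ∀ x, HasDerivAt U1 (U2 x) x)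
    (heq : ∀ s, U2 s + (D-4) * U1 s + (3-D) * U s + q s * U s = f s)
    (hq : ∀ s ≤ s1, |q s| ≤ 1)
    (hf : ∀ s ≤ s1, |f s| ≤ η * Real.exp s ^ 3)
    (hO : U =O[atBot] fun s => Real.exp s ^ 3) :
    ∀ s ≤ s1, U s ^ 2 + (U1 s - U s) ^ 2 ≤ η ^ 2 * Real.exp s ^ 6 := by
  -- bound on derivative at minus infinity
  obtain ⟨C0, hC0, hOC⟩ := hO.exists_pos
  rw [IsBigOWith, eventually_atBot] at hOC
  obtain ⟨s2, hs2⟩ := hOC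
  set C1 := D * C0 + η with hC1
  have hU1 : ∀ s ≤ min s1 s2, |U1 s| ≤ (3 + 2 * (D-4)) * (C1 * Real.exp s ^ 3) := by
    intro s hs
    have hsa := hs.trans (min_le_left _ _)
    have hsb := hs.trans (min_le_right _ _)
    have key : ∀ x ∈ Icc (s-1) s, |U x| ≤ C0 * Real.exp s ^ 3 ∧ |f x| ≤ η * Real.exp s ^ 3 := by
      intro x hx
      have hxe : Real.exp x ^ 3 ≤ Real.exp s ^ 3 := by
        gcongr; exact hx.2
      have := hs2 x (hx.2.trans hsb)
      simp only [Real.norm_eq_abs, abs_pow, Real.abs_exp] at this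
      exact ⟨this.trans (by gcongr), (hf x (hx.2.trans hsa)).trans (by gcongr)⟩
    have e3 : 0 < Real.exp s ^ 3 := by positivity
    refine interp_deriv (by linarith) h1 h2 ?_ ?_
    · intro x hx
      refine (key x hx).1.trans ?_
      gcongr
      nlinarith
    · intro x hx
      have k1 := key x hx
      have hqx := hq x (hx.2.trans hsa)
      have e : U2 x + (D-4) * U1 x = (D - 3 - q x) * U x + f x := by linarith [heq x]
      rw [e]
      have hqq : |D - 3 - q x| ≤ D := by
        rw [abs_le] at *; constructor <;> linarith
      calc |(D - 3 - q x) * U x + f x| ≤ |(D - 3 - q x) * U x| + |f x| := abs_add_le _ _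
        _ = |D - 3 - q x| * |U x| + |f x| := by rw [abs_mul]
        _ ≤ D * (C0 * Real.exp s ^ 3) + η * Real.exp s ^ 3 := by
            gcongr
            · exact k1.1
            · exact k1.2
        _ = C1 * Real.exp s ^ 3 := by rw [hC1]; ring
  set V := fun s => U s ^ 2 + (U1 s - U s) ^ 2 with hV
  have hVd : ∀ s, HasDerivAt V (2 * U s * U1 s + 2 * (U1 s - U s) * (U2 s - U1 s)) s := by
    intro s
    have := ((h1 s).pow 2).add ((((h2 s).sub (h1 s))).pow 2)
    refine this.congr_deriv ?_
    simp
  have hanti := comparison (k := 4) (m := 6) (θ := -1/2) (A := η^2) (convex_Iic s1) hVd (by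
    intro s hs
    have hqs := hq s hs
    have hfs := hf s hs
    have e : U2 s = -(D-4) * U1 s - (3-D) * U s - q s * U s + f s := by linarith [heq s]
    have e6 : Real.exp (6 * s) = Real.exp s ^ 6 := by exact_mod_cast exp_mul_nat 6 s
    rw [e, e6]
    have hf2 : f s ^ 2 ≤ η ^ 2 * Real.exp s ^ 6 := by
      rw [← sq_abs]
      calc |f s|^2 ≤ (η * Real.exp s ^ 3)^2 := by gcongr
        _ = _ := by ring
    refine le_trans ?_ (add_le_add_right hf2 _)
    set w := U1 s - U s with hw
    have hU1e : U1 s = U s + w := by rw [hw]; ring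
    simp only [hV]
    rw [← hw, hU1e]
    have hqU : -(2 * w * (q s * U s)) ≤ w^2 + U s ^ 2 := by
      have : q s ^ 2 ≤ 1 := by rw [← sq_abs]; nlinarith [abs_nonneg (q s)]
      nlinarith [sq_nonneg (w + q s * U s), sq_nonneg (U s)]
    nlinarith [sq_nonneg (w - f s), sq_nonneg (w - U s), sq_nonneg w, sq_nonneg (U s),
      mul_nonneg (sub_nonneg.2 hD) (sq_nonneg w)]) (sq_nonneg η) (by norm_num)
  -- tends to zero
  have hlim : Tendsto (fun s => Real.exp (-4 * s) * (V s + -1/2 * η^2 * Real.exp (6 * s)))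
      atBot (𝓝 0) := by
    set C2 := C0 ^ 2 + ((3 + 2 * (D-4)) * C1 + C0)^2 + η^2 with hC2
    have hz : Tendsto (fun s => C2 * Real.exp s ^ 2) atBot (𝓝 0) := by
      have := ((Real.tendsto_exp_atBot).pow 2).const_mul C2
      simpa using this
    refine squeeze_zero_norm' ?_ hz
    filter_upwards [eventually_le_atBot (min s1 s2)] with s hs
    have hsb := hs.trans (min_le_right _ _)
    have u1 := hU1 s hs
    have u0 := hs2 s hsb
    simp only [Real.norm_eq_abs, abs_pow, Real.abs_exp] at u0
    have e6 : Real.exp (6 * s) = Real.exp s ^ 6 := by exact_mod_cast exp_mul_nat 6 s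
    have e4 : Real.exp (-4 * s) * Real.exp s ^ 6 = Real.exp s ^ 2 := by
      rw [← Real.exp_nat_mul, ← Real.exp_nat_mul, ← Real.exp_add]; congr 1; push_cast; ring
    have hE := Real.exp_pos s
    have v1 : U s ^ 2 ≤ C0^2 * Real.exp s ^ 6 := by
      rw [← sq_abs]
      calc |U s|^2 ≤ (C0 * Real.exp s ^ 3)^2 := by gcongr
        _ = _ := by ring
    have v2 : (U1 s - U s) ^ 2 ≤ ((3 + 2 * (D-4)) * C1 + C0)^2 * Real.exp s ^ 6 := by
      rw [← sq_abs]
      calc |U1 s - U s|^2 ≤ (((3 + 2 * (D-4)) * C1 + C0) * Real.exp s ^ 3)^2 := by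
            gcongr
            calc |U1 s - U s| ≤ |U1 s| + |U s| := abs_sub _ _
              _ ≤ _ := by rw [add_mul, mul_assoc]; exact add_le_add u1 u0
        _ = _ := by ring
    rw [Real.norm_eq_abs, abs_mul, Real.abs_exp, e6, ← e4]
    calc Real.exp (-4 * s) * |V s + -1/2 * η^2 * Real.exp s ^ 6|
        ≤ Real.exp (-4 * s) * (C2 * Real.exp s ^ 6) := by
          gcongr
          have : 0 ≤ η^2 * Real.exp s ^ 6 := by positivity
          have : 0 ≤ V s := by positivity
          rw [abs_le, hC2]
          constructor
          · have : 0 ≤ (C0^2 + ((3 + 2 * (D-4)) * C1 + C0)^2) * Real.exp s ^ 6 := by positivity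
            nlinarith
          · simp only [hV]; nlinarith
      _ = _ := by ring
  intro s hs
  have hle : Real.exp (-4 * s) * (V s + -1/2 * η^2 * Real.exp (6 * s)) ≤ 0 := by
    refine ge_of_tendsto hlim ?_
    filter_upwards [eventually_le_atBot s] with x hx
    exact hanti (hx.trans hs) hs hx
  have e6 : Real.exp (6 * s) = Real.exp s ^ 6 := by exact_mod_cast exp_mul_nat 6 s
  have : V s + -1/2 * η^2 * Real.exp (6 * s) ≤ 0 := by
    by_contra hcon
    push Not at hcon
    have := mul_pos (Real.exp_pos (-4*s)) hcon
    linarith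
  rw [e6] at this
  have : 0 ≤ η^2 * Real.exp s ^ 6 := by positivity
  simp only [hV] at *
  linarith

lemma energy_deriv {p : ℝ} {U U1 U2 : ℝ → ℝ}
    (h1 : ∀ x, HasDerivAt U (U1 x) x) (h2 : ∀ x, HasDerivAt U1 (U2 x) x) (s : ℝ) :
    HasDerivAt (fun s => U s ^ 2 + (U1 s - p * U s) ^ 2)
      (2 * U s * U1 s + 2 * (U1 s - p * U s) * (U2 s - p * U1 s)) s := by
  have := ((h1 s).pow 2).add ((((h2 s).sub ((h1 s).const_mul p))).pow 2)
  refine this.congr_deriv ?_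
  simp

set_option maxHeartbeats 1000000 in
/-- The main linear estimate. -/
lemma linear_estimate {D p m : ℝ} (hD : 13 ≤ D) (hpm : p + m = -(D-4)) (hpm' : p * m = 2 * (D-3))
    (hmp : m < p) (hp : p < -2) {S1 S2 K : ℝ} (hS1 : S1 ≤ 0) (hS2 : 0 ≤ S2) (hK : 0 ≤ K) :
    ∃ C > 0, ∀ (U U1 U2 q f : ℝ → ℝ) (η s0 : ℝ), 0 ≤ η →
      (∀ x, HasDerivAt U (U1 x) x) → (∀ x, HasDerivAt U1 (U2 x) x) →
      (∀ s, U2 s + (D-4) * U1 s + (3-D) * U s + q s * U s = f s) →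
      (∀ s ≤ s0, s ≤ S1 → |q s| ≤ 1) → (∀ s ≤ s0, |q s| ≤ K) →
      (∀ s ≤ s0, S2 ≤ s → |q s - 3 * (D-3)| ≤ 1) →
      (∀ s ≤ s0, |f s| ≤ η * (Real.exp s ^ 2 * min 1 (Real.exp s))) →
      (U =O[atBot] fun s => Real.exp s ^ 3) →
      ∀ s ≤ s0, |U s| ≤ C * η * (Real.exp s ^ 2 * min 1 (Real.exp s)) := by
  set k := K + 3 * D + 10 with hk
  set c1 := 3 + 2 * (1 - p)^2 with hc1
  set c2 := Real.exp (k * (S2 - S1)) * (c1 + 1) with hc2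
  set C := 1 + (c2 + 1) / Real.exp S1 with hC
  have hc1p : 0 < c1 := by positivity
  have hc2p : 0 < c2 := by positivity
  have hES1 : 0 < Real.exp S1 := Real.exp_pos _
  have hES1' : Real.exp S1 ≤ 1 := Real.exp_le_one_iff.mpr hS1
  have hCp : 1 ≤ C := by
    have : 0 ≤ (c2 + 1) / Real.exp S1 := by positivity
    linarith
  refine ⟨C, by linarith, ?_⟩
  intro U U1 U2 q f η s0 hη h1 h2 heq hqa hqb hqc hf hO
  have hmu : ∀ s, 0 < min 1 (Real.exp s) := fun s => lt_min one_pos (Real.exp_pos s)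
  have hf3 : ∀ s ≤ s0, |f s| ≤ η * Real.exp s ^ 3 := by
    intro s hs
    refine (hf s hs).trans ?_
    have : min 1 (Real.exp s) ≤ Real.exp s := min_le_right _ _
    calc η * (Real.exp s ^ 2 * min 1 (Real.exp s)) ≤ η * (Real.exp s ^ 2 * Real.exp s) := by gcongr
      _ = _ := by ring
  have hf2 : ∀ s ≤ s0, f s ^ 2 ≤ η ^ 2 * Real.exp s ^ 4 := by
    intro s hs
    rw [← sq_abs]
    have : min 1 (Real.exp s) ≤ 1 := min_le_left _ _
    calc |f s| ^ 2 ≤ (η * (Real.exp s ^ 2 * 1)) ^ 2 := by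
          gcongr
          refine (hf s hs).trans ?_
          gcongr
      _ = _ := by ring
  have e4 : ∀ s, Real.exp (4 * s) = Real.exp s ^ 4 := fun s => by exact_mod_cast exp_mul_nat 4 s
  have R1 := region1 (s1 := min s0 S1) hD hη h1 h2 heq
    (fun s hs => hqa s (hs.trans (min_le_left _ _)) (hs.trans (min_le_right _ _)))
    (fun s hs => hf3 s (hs.trans (min_le_left _ _))) hO
  set V := fun s => U s ^ 2 + (U1 s - p * U s) ^ 2 with hV
  have hVd := energy_deriv (p := p) h1 h2
  have hUV : ∀ s, U s ^ 2 ≤ V s := fun s => by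
    simp only [hV]; nlinarith [sq_nonneg (U1 s - p * U s)]
  -- the energy derivative
  have hform : ∀ s, 2 * U s * U1 s + 2 * (U1 s - p * U s) * (U2 s - p * U1 s)
      = 2 * p * U s ^ 2 + 2 * m * (U1 s - p * U s)^2
        + 2 * (1 + (3 * (D-3) - q s)) * (U s * (U1 s - p * U s)) + 2 * (U1 s - p * U s) * f s := by
    intro s
    have e : U2 s = (p + m) * U1 s - p * m * U s + (3 * (D-3) - q s) * U s + f s := by
      rw [hpm, hpm']; linarith [heq s]
    rw [e]; ring
  have hgen : ∀ s, ∀ L : ℝ, |3 * (D-3) - q s| ≤ L →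
      2 * U s * U1 s + 2 * (U1 s - p * U s) * (U2 s - p * U1 s)
      ≤ (2 * p + 1 + L) * U s ^ 2 + (2 * m + 2 + L) * (U1 s - p * U s)^2 + f s ^ 2 := by
    intro s L hL
    rw [hform]
    set w := U1 s - p * U s
    have h3 : 2 * (1 + (3 * (D-3) - q s)) * (U s * w) ≤ (1 + L) * (U s ^ 2 + w ^ 2) := by
      have hx : |1 + (3 * (D-3) - q s)| ≤ 1 + L := by
        calc _ ≤ |(1:ℝ)| + |3 * (D-3) - q s| := abs_add_le _ _
          _ ≤ _ := by rw [abs_one]; linarith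
      have hy : |2 * (U s * w)| ≤ U s ^ 2 + w ^ 2 := by
        rw [abs_le]; constructor <;> nlinarith [sq_nonneg (U s - w), sq_nonneg (U s + w)]
      calc 2 * (1 + (3 * (D-3) - q s)) * (U s * w) = (1 + (3 * (D-3) - q s)) * (2 * (U s * w)) := by
            ring
        _ ≤ |(1 + (3 * (D-3) - q s)) * (2 * (U s * w))| := le_abs_self _
        _ = |1 + (3 * (D-3) - q s)| * |2 * (U s * w)| := abs_mul _ _
        _ ≤ _ := mul_le_mul hx hy (abs_nonneg _) ((abs_nonneg _).trans hx)
    nlinarith [sq_nonneg (w - f s)]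
  -- bound for first region
  have B1 : ∀ s ≤ s0, s ≤ S1 → |U s| ≤ η * Real.exp s ^ 3 := by
    intro s hs hs'
    apply abs_le_of_sq_le_sq _ (by positivity)
    have := R1 s (le_min hs hs')
    nlinarith [sq_nonneg (U1 s - U s)]
  -- bound for second region
  have hV1 : S1 ≤ s0 → V S1 ≤ c1 * η ^ 2 * Real.exp S1 ^ 4 := by
    intro h
    have r := R1 S1 (le_min h le_rfl)
    have hle : Real.exp S1 ^ 6 ≤ Real.exp S1 ^ 4 :=
      pow_le_pow_of_le_one hES1.le hES1' (by norm_num)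
    have : V S1 ≤ c1 * (U S1 ^ 2 + (U1 S1 - U S1)^2) := by
      simp only [hV, hc1]
      set w := U1 S1 - U S1
      have : U1 S1 - p * U S1 = w + (1-p) * U S1 := by simp only [w]; ring
      rw [this]
      nlinarith [sq_nonneg (w - (1-p) * U S1), sq_nonneg w, sq_nonneg (U S1),
        mul_nonneg (sq_nonneg (1-p)) (sq_nonneg w)]
    calc V S1 ≤ c1 * (U S1 ^ 2 + (U1 S1 - U S1)^2) := this
      _ ≤ c1 * (η ^ 2 * Real.exp S1 ^ 6) := by gcongr
      _ ≤ c1 * (η ^ 2 * Real.exp S1 ^ 4) := by gcongr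
      _ = _ := by ring
  have B2 : ∀ s ≤ s0, S1 ≤ s → s ≤ S2 → V s ≤ c2 * η ^ 2 * Real.exp s ^ 4 := by
    intro s hs hs1 hs2
    have anti := comparison (k := k) (m := 4) (θ := 1) (A := η^2) (convex_Icc S1 s) hVd (by
      intro x hx
      have hq := hqb x (hx.2.trans hs)
      have hL : |3 * (D-3) - q x| ≤ K + 3 * D := by
        rw [abs_le] at *; constructor <;> linarith
      have := hgen x _ hL
      have f2 := hf2 x (hx.2.trans hs)
      rw [e4]
      nlinarith [sq_nonneg (U x), sq_nonneg (U1 x - p * U x)]) (sq_nonneg η) (by linarith)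
    have := anti (left_mem_Icc.2 hs1) (right_mem_Icc.2 hs1) hs1
    simp only [e4, one_mul] at this
    have v1 := hV1 (hs1.trans hs)
    have hee : Real.exp S1 ^ 4 ≤ Real.exp s ^ 4 := by gcongr
    have hpos : 0 < Real.exp (-k * s) := Real.exp_pos _
    have hratio : Real.exp (-k * S1) ≤ Real.exp (-k * s) * Real.exp (k * (S2 - S1)) := by
      rw [← Real.exp_add]
      apply Real.exp_le_exp.2
      have : 0 ≤ k := by linarith
      nlinarith
    have : Real.exp (-k * s) * V s ≤ Real.exp (-k * s) * (c2 * η ^ 2 * Real.exp s ^ 4) := by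
      calc Real.exp (-k * s) * V s ≤ Real.exp (-k * s) * (V s + η ^ 2 * Real.exp s ^ 4) := by
            gcongr
            have : 0 ≤ η ^ 2 * Real.exp s ^ 4 := by positivity
            linarith
        _ ≤ Real.exp (-k * S1) * (V S1 + η ^ 2 * Real.exp S1 ^ 4) := this
        _ ≤ Real.exp (-k * S1) * ((c1 + 1) * η ^ 2 * Real.exp s ^ 4) := by
            gcongr
            have : (c1 + 1) * η ^ 2 * Real.exp S1 ^ 4 ≤ (c1 + 1) * η ^ 2 * Real.exp s ^ 4 := by gcongr
            linarith
        _ ≤ Real.exp (-k * s) * Real.exp (k * (S2 - S1)) * ((c1 + 1) * η ^ 2 * Real.exp s ^ 4) := by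
            gcongr
        _ = _ := by rw [hc2]; ring
    exact le_of_mul_le_mul_left this hpos
  have B3 : ∀ s ≤ s0, S2 ≤ s → V s ≤ (c2 + 1) * η ^ 2 * Real.exp s ^ 4 := by
    intro s hs hs2
    have anti := comparison (k := -1) (m := 4) (θ := -1) (A := η^2) (convex_Icc S2 s) hVd (by
      intro x hx
      have hq := hqc x (hx.2.trans hs) hx.1
      have hL : |3 * (D-3) - q x| ≤ 1 := by rw [abs_sub_comm]; exact hq
      have := hgen x _ hL
      have f2 := hf2 x (hx.2.trans hs)
      rw [e4]
      nlinarith [sq_nonneg (U x), sq_nonneg (U1 x - p * U x)]) (sq_nonneg η) (by norm_num)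
    have := anti (left_mem_Icc.2 hs2) (right_mem_Icc.2 hs2) hs2
    simp only [e4, neg_neg, one_mul] at this
    have v2 := B2 S2 (hs2.trans hs) (hS1.trans hS2) le_rfl
    have hee : Real.exp S2 ^ 4 ≤ Real.exp s ^ 4 := by gcongr
    have hee1 : Real.exp S2 ≤ Real.exp s := by gcongr
    have hpos : 0 < Real.exp s := Real.exp_pos _
    have h0 : 0 ≤ η ^ 2 * Real.exp S2 ^ 4 := by positivity
    have h00 : 0 ≤ c2 * η ^ 2 * Real.exp s ^ 4 := by positivity
    have : Real.exp s * (V s + -1 * η ^ 2 * Real.exp s ^ 4)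
        ≤ Real.exp s * (c2 * η ^ 2 * Real.exp s ^ 4) := by
      calc _ ≤ Real.exp S2 * (V S2 + -1 * η ^ 2 * Real.exp S2 ^ 4) := this
        _ ≤ Real.exp S2 * (c2 * η ^ 2 * Real.exp s ^ 4) := by
            gcongr
            have : c2 * η ^ 2 * Real.exp S2 ^ 4 ≤ c2 * η ^ 2 * Real.exp s ^ 4 := by gcongr
            linarith
        _ ≤ _ := by gcongr
    have := le_of_mul_le_mul_left this hpos
    linarith
  intro s hs
  rcases le_total s S1 with h | h
  · have hmin : min 1 (Real.exp s) = Real.exp s :=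
      min_eq_right (Real.exp_le_one_iff.mpr (h.trans hS1))
    rw [hmin]
    refine (B1 s hs h).trans ?_
    have : 0 ≤ η * Real.exp s ^ 3 := by positivity
    nlinarith
  · have hVs : V s ≤ (c2 + 1) * η ^ 2 * Real.exp s ^ 4 := by
      rcases le_total s S2 with h' | h'
      · refine (B2 s hs h h').trans ?_
        gcongr
        linarith
      · exact B3 s hs h'
    have hmuS : Real.exp S1 ≤ min 1 (Real.exp s) := le_min hES1' (by gcongr)
    have : |U s| ≤ (c2 + 1) * η * Real.exp s ^ 2 := by
      apply abs_le_of_sq_le_sq _ (by positivity)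
      calc U s ^ 2 ≤ (c2 + 1) * η ^ 2 * Real.exp s ^ 4 := (hUV s).trans hVs
        _ ≤ (c2 + 1)^2 * η ^ 2 * Real.exp s ^ 4 := by
            gcongr
            nlinarith
        _ = _ := by ring
    refine this.trans ?_
    have hCS : c2 + 1 ≤ C * min 1 (Real.exp s) := by
      calc c2 + 1 = (c2 + 1) / Real.exp S1 * Real.exp S1 := by field_simp
        _ ≤ C * min 1 (Real.exp s) := by
            gcongr
            rw [hC]; linarith
    calc (c2 + 1) * η * Real.exp s ^ 2 ≤ (C * min 1 (Real.exp s)) * η * Real.exp s ^ 2 := by gcongr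
      _ = _ := by ring

lemma bootstrap {h : ℝ → ℝ} {s0 : ℝ} (hc : Continuous h) (hbot : ∀ᶠ s in atBot, h s ≤ 0)
    (hstep : ∀ s' ≤ s0, (∀ s ≤ s', h s ≤ 0) → h s' < 0) : ∀ s ≤ s0, h s ≤ 0 := by
  by_contra hcon
  push Not at hcon
  obtain ⟨x, hx, hxp⟩ := hcon
  set B := {s | s ≤ s0 ∧ 0 < h s} with hB
  have hne : B.Nonempty := ⟨x, hx, hxp⟩
  obtain ⟨s1, hs1⟩ := eventually_atBot.1 hbot
  have hbd : BddBelow B := ⟨s1, fun y hy => by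
    by_contra hlt
    push Not at hlt
    exact absurd (hs1 y hlt.le) (not_le.2 hy.2)⟩
  set s' := sInf B with hs'
  have hs0 : s' ≤ s0 := (csInf_le hbd ⟨hx, hxp⟩).trans hx
  have hlt : ∀ s < s', h s ≤ 0 := by
    intro s hs
    by_contra hp
    push Not at hp
    exact absurd (csInf_le hbd (show s ∈ B from ⟨hs.le.trans hs0, hp⟩)) (not_le.2 hs)
  have hle : ∀ s ≤ s', h s ≤ 0 := by
    intro s hs
    rcases hs.lt_or_eq with h1 | h1
    · exact hlt s h1
    · rw [h1]
      have ht : Tendsto h (𝓝[<] s') (𝓝 (h s')) := (hc.tendsto s').mono_left nhdsWithin_le_nhds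
      refine le_of_tendsto ht ?_
      filter_upwards [self_mem_nhdsWithin] with y hy using hlt y hy
  have hneg := hstep s' hs0 hle
  have hcl : s' ∈ closure B := csInf_mem_closure hne hbd
  rw [mem_closure_iff_nhds] at hcl
  obtain ⟨y, hy1, hy2⟩ := hcl {y | h y < 0} ((hc.tendsto s').eventually (gt_mem_nhds hneg))
  exact absurd hy1 (not_lt.2 hy2.2.le)

lemma quad_bound {X Y N μ : ℝ} (hX : |X| ≤ N * μ) (hY : |Y| ≤ N * μ) :
    |X ^ 2 + X * Y + Y ^ 2| ≤ 3 * N ^ 2 * μ ^ 2 := by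
  have h0 : 0 ≤ N * μ := (abs_nonneg _).trans hX
  have h1 : |X ^ 2| ≤ (N * μ) ^ 2 := by rw [abs_pow]; gcongr
  have h2 : |Y ^ 2| ≤ (N * μ) ^ 2 := by rw [abs_pow]; gcongr
  have h3 : |X * Y| ≤ (N * μ) * (N * μ) := by rw [abs_mul]; gcongr
  calc _ ≤ |X ^ 2 + X * Y| + |Y ^ 2| := abs_add_le _ _
    _ ≤ |X ^ 2| + |X * Y| + |Y ^ 2| := by gcongr; exact abs_add_le _ _
    _ ≤ _ := by nlinarith

lemma prod_close {X Y N r δ : ℝ} (hr : 0 ≤ r) (hrN : r ≤ N) (hY : |Y| ≤ N)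
    (hXr : |X - r| ≤ δ) (hYr : |Y - r| ≤ δ) : |X * Y - r ^ 2| ≤ 2 * N * δ := by
  have h0 : 0 ≤ δ := (abs_nonneg _).trans hXr
  have e : X * Y - r ^ 2 = (X - r) * Y + r * (Y - r) := by ring
  rw [e]
  calc _ ≤ |(X - r) * Y| + |r * (Y - r)| := abs_add_le _ _
    _ = |X - r| * |Y| + r * |Y - r| := by rw [abs_mul, abs_mul, abs_of_nonneg hr]
    _ ≤ δ * N + N * δ := by
        have : 0 ≤ N := hr.trans hrN
        gcongr
    _ = _ := by ring

lemma quad_close {X Y N r δ : ℝ} (hr : 0 ≤ r) (hrN : r ≤ N) (hX : |X| ≤ N) (hY : |Y| ≤ N)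
    (hXr : |X - r| ≤ δ) (hYr : |Y - r| ≤ δ) :
    |X ^ 2 + X * Y + Y ^ 2 - 3 * r ^ 2| ≤ 6 * N * δ := by
  have h1 := prod_close hr hrN hX hXr hXr
  have h2 := prod_close hr hrN hY hXr hYr
  have h3 := prod_close hr hrN hY hYr hYr
  rw [abs_le] at *
  constructor <;> nlinarith

lemma P_bound {lam y : ℝ} (hy : 0 ≤ y) (hy1 : y ≤ 1) :
    |lam * y - y ^ 2| ≤ (|lam| + 1) * y := by
  have e : lam * y - y ^ 2 = (lam - y) * y := by ring
  rw [e, abs_mul, abs_of_nonneg hy]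
  gcongr
  calc |lam - y| ≤ |lam| + |y| := abs_sub _ _
    _ ≤ _ := by rw [abs_of_nonneg hy]; linarith

set_option maxHeartbeats 1000000 in
lemma perturb {D p m lam r M S2 : ℝ} (hD : 13 ≤ D) (hpm : p + m = -(D-4))
    (hpm' : p * m = 2 * (D-3)) (hmp : m < p) (hp : p < -2) (hr : 0 ≤ r) (hr2 : r ^ 2 = D - 3)
    (hM : 1 ≤ M) (hrM : r ≤ M) (hS2 : 0 ≤ S2) {Θ Θ1 Θ2 Θ3 : ℝ → ℝ}
    (hΘ1 : ∀ x, HasDerivAt Θ (Θ1 x) x) (hΘ2 : ∀ x, HasDerivAt Θ1 (Θ2 x) x)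
    (hΘ3 : ∀ x, HasDerivAt Θ2 (Θ3 x) x)
    (hΘeq : ∀ s, Θ2 s + (D-4) * Θ1 s + (3-D) * Θ s + Θ s ^ 3 = 0)
    (hΘeq' : ∀ s, Θ3 s + (D-4) * Θ2 s + (3-D) * Θ1 s + 3 * Θ s ^ 2 * Θ1 s = 0)
    (hΘb : ∀ s, |Θ s| ≤ M * min 1 (Real.exp s)) (hΘ1b : ∀ s, |Θ1 s| ≤ M * min 1 (Real.exp s))
    (hΘr : ∀ s, S2 ≤ s → |Θ s - r| ≤ 1 / (24 * (M + 1))) :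
    ∃ C > 0, ∃ η0 > 0, ∀ (ε s0 : ℝ) (Φ Φ1 Φ2 g g1 g2 : ℝ → ℝ), 0 < ε → ε ≤ 1 →
      ε * Real.exp s0 ^ 2 ≤ η0 →
      (∀ x, HasDerivAt Φ (Φ1 x) x) → (∀ x, HasDerivAt Φ1 (Φ2 x) x) →
      (∀ x, HasDerivAt g (g1 x) x) → (∀ x, HasDerivAt g1 (g2 x) x) →
      (∀ s, Φ2 s + (D-4) * Φ1 s + (3-D) * Φ s + Φ s ^ 3
        + (lam * (ε * Real.exp s ^ 2) - (ε * Real.exp s ^ 2) ^ 2) * Φ s = 0) →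
      (∀ s, g2 s + (D-4) * g1 s + (3-D) * g s + 3 * Φ s ^ 2 * g s
        + (lam * (ε * Real.exp s ^ 2) - (ε * Real.exp s ^ 2) ^ 2) * g s = 0) →
      ((fun s => Φ s - Θ s) =O[atBot] fun s => Real.exp s ^ 3) →
      ((fun s => g s - Θ1 s) =O[atBot] fun s => Real.exp s ^ 3) →
      |g s0 - Θ1 s0| ≤ C * (ε * Real.exp s0 ^ 2) := by
  set N := M + 1 with hN
  set L := |lam| + 1 with hL
  have hL1 : 1 ≤ L := by have := abs_nonneg lam; linarith
  set K := 3 * N ^ 2 + L with hK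
  have hK1 : 1 ≤ K := by nlinarith
  have hKp : 0 < K := by linarith
  set S1 := -Real.log K with hS1
  have hS1' : S1 ≤ 0 := by have := Real.log_nonneg hK1; linarith
  have hexpS1 : Real.exp S1 = K⁻¹ := by rw [hS1, Real.exp_neg, Real.exp_log hKp]
  obtain ⟨C1, hC1, hlin⟩ := linear_estimate hD hpm hpm' hmp hp (K := K) hS1' hS2 hKp.le
  set δ := 1 / (24 * N) with hδ
  have hNp : 0 < N := by linarith
  have hδp : 0 < δ := by positivity
  have hδ1 : δ ≤ 1 := by rw [hδ, div_le_one (by positivity)]; linarith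
  have hMp : 0 < M := by linarith
  have hLp : 0 < L := by linarith
  have hCLM : 0 < C1 * L * M := by positivity
  set η0 := min 1 (min (1 / (2 * L)) (δ / (2 * (C1 * L * M)))) with hη0
  have hη0p : 0 < η0 := lt_min one_pos (lt_min (by positivity) (by positivity))
  have hη1 : η0 ≤ 1 := min_le_left _ _
  have hη2 : L * η0 ≤ 1 / 2 := by
    have : η0 ≤ 1 / (2 * L) := (min_le_right _ _).trans (min_le_left _ _)
    calc L * η0 ≤ L * (1 / (2 * L)) := by gcongr
      _ = 1/2 := by field_simp
  have hη3 : C1 * L * M * η0 ≤ δ / 2 := by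
    have : η0 ≤ δ / (2 * (C1 * L * M)) := (min_le_right _ _).trans (min_le_right _ _)
    calc C1 * L * M * η0 ≤ C1 * L * M * (δ / (2 * (C1 * L * M))) := by gcongr
      _ = δ / 2 := by field_simp
  refine ⟨C1 * (L * M * (1 + 6 * N * C1 * M)), by positivity, η0, hη0p, ?_⟩
  intro ε s0 Φ Φ1 Φ2 g g1 g2 hε hε1 hεs hΦ1 hΦ2 hg1 hg2 hΦeq hgeq hDO hGO
  have hmu : ∀ s, 0 < min 1 (Real.exp s) := fun s => lt_min one_pos (Real.exp_pos s)
  have hmu1 : ∀ s, min 1 (Real.exp s) ≤ 1 := fun s => min_le_left _ _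
  have hy : ∀ s ≤ s0, ε * Real.exp s ^ 2 ≤ η0 := by
    intro s hs
    refine le_trans ?_ hεs
    gcongr
  have hPb : ∀ s ≤ s0, |lam * (ε * Real.exp s ^ 2) - (ε * Real.exp s ^ 2) ^ 2|
      ≤ L * (ε * Real.exp s ^ 2) :=
    fun s hs => P_bound (by positivity) ((hy s hs).trans hη1)
  -- coefficient bounds
  have hq : ∀ (X Y : ℝ → ℝ) (s' : ℝ), s' ≤ s0 → (∀ s ≤ s', |X s| ≤ N * min 1 (Real.exp s)) →
      (∀ s ≤ s', |Y s| ≤ N * min 1 (Real.exp s)) →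
      (∀ s ≤ s', S2 ≤ s → |X s - r| ≤ 2 * δ) → (∀ s ≤ s', S2 ≤ s → |Y s - r| ≤ 2 * δ) →
      (∀ s ≤ s', s ≤ S1 → |X s ^ 2 + X s * Y s + Y s ^ 2
        + (lam * (ε * Real.exp s ^ 2) - (ε * Real.exp s ^ 2) ^ 2)| ≤ 1) ∧
      (∀ s ≤ s', |X s ^ 2 + X s * Y s + Y s ^ 2
        + (lam * (ε * Real.exp s ^ 2) - (ε * Real.exp s ^ 2) ^ 2)| ≤ K) ∧
      (∀ s ≤ s', S2 ≤ s → |X s ^ 2 + X s * Y s + Y s ^ 2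
        + (lam * (ε * Real.exp s ^ 2) - (ε * Real.exp s ^ 2) ^ 2) - 3 * (D-3)| ≤ 1) := by
    intro X Y s' hs' hX hY hXr hYr
    refine ⟨?_, ?_, ?_⟩
    · intro s hs hsS
      have a1 := quad_bound (hX s hs) (hY s hs)
      have a2 := hPb s (hs.trans hs')
      have a3 : min 1 (Real.exp s) ≤ Real.exp s := min_le_right _ _
      have a4 : Real.exp s ≤ K⁻¹ := by rw [← hexpS1]; gcongr
      have := hmu s
      calc _ ≤ |X s ^ 2 + X s * Y s + Y s ^ 2|
            + |lam * (ε * Real.exp s ^ 2) - (ε * Real.exp s ^ 2) ^ 2| := abs_add_le _ _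
        _ ≤ 3 * N ^ 2 * min 1 (Real.exp s) ^ 2 + L * (ε * Real.exp s ^ 2) := add_le_add a1 a2
        _ ≤ 3 * N ^ 2 * Real.exp s ^ 2 + L * (1 * Real.exp s ^ 2) := by gcongr
        _ = K * Real.exp s ^ 2 := by rw [hK]; ring
        _ ≤ K * K⁻¹ ^ 2 := by gcongr
        _ = K⁻¹ := by field_simp
        _ ≤ 1 := inv_le_one_of_one_le₀ hK1
    · intro s hs
      have a1 := quad_bound (hX s hs) (hY s hs)
      have a2 := hPb s (hs.trans hs')
      have a3 := hmu1 s
      have := hmu s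
      calc _ ≤ |X s ^ 2 + X s * Y s + Y s ^ 2|
            + |lam * (ε * Real.exp s ^ 2) - (ε * Real.exp s ^ 2) ^ 2| := abs_add_le _ _
        _ ≤ 3 * N ^ 2 * min 1 (Real.exp s) ^ 2 + L * (ε * Real.exp s ^ 2) := add_le_add a1 a2
        _ ≤ 3 * N ^ 2 * 1 ^ 2 + L * 1 := by
            gcongr
            exact (hy s (hs.trans hs')).trans hη1
        _ = K := by rw [hK]; ring
    · intro s hs hsS
      have b1 : |X s| ≤ N := (hX s hs).trans (by have := hmu1 s; nlinarith)
      have b2 : |Y s| ≤ N := (hY s hs).trans (by have := hmu1 s; nlinarith)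
      have a1 := quad_close hr (by linarith) b1 b2 (hXr s hs hsS) (hYr s hs hsS)
      have a2 := hPb s (hs.trans hs')
      have a5 : L * (ε * Real.exp s ^ 2) ≤ 1 / 2 :=
        le_trans (by gcongr; exact hy s (hs.trans hs')) hη2
      have a6 : 6 * N * (2 * δ) = 1 / 2 := by rw [hδ]; field_simp; norm_num
      rw [a6, hr2] at a1
      rw [abs_le] at *
      constructor <;> linarith
  have hΘN : ∀ s, |Θ s| ≤ N * min 1 (Real.exp s) := fun s =>
    (hΘb s).trans (by have := hmu s; nlinarith)
  have hΘr' : ∀ s, S2 ≤ s → |Θ s - r| ≤ 2 * δ := fun s hs => (hΘr s hs).trans (by linarith)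
  have hsmall : ∀ s' ≤ s0, (∀ s ≤ s', |Φ s - Θ s| ≤ δ * min 1 (Real.exp s)) →
      (∀ s ≤ s', |Φ s| ≤ N * min 1 (Real.exp s)) ∧ (∀ s ≤ s', S2 ≤ s → |Φ s - r| ≤ 2 * δ) := by
    intro s' hs' hb
    constructor
    · intro s hs
      have := hmu s
      calc |Φ s| = |(Φ s - Θ s) + Θ s| := by ring_nf
        _ ≤ |Φ s - Θ s| + |Θ s| := abs_add_le _ _
        _ ≤ δ * min 1 (Real.exp s) + M * min 1 (Real.exp s) := add_le_add (hb s hs) (hΘb s)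
        _ ≤ _ := by rw [hN]; nlinarith
    · intro s hs hsS
      have := hmu1 s
      calc |Φ s - r| = |(Φ s - Θ s) + (Θ s - r)| := by ring_nf
        _ ≤ |Φ s - Θ s| + |Θ s - r| := abs_add_le _ _
        _ ≤ δ * min 1 (Real.exp s) + δ := add_le_add (hb s hs) (hΘr s hsS)
        _ ≤ _ := by nlinarith
  -- the bootstrap step
  have hDest : ∀ s' ≤ s0, (∀ s ≤ s', |Φ s - Θ s| ≤ δ * min 1 (Real.exp s)) →
      ∀ s ≤ s', |Φ s - Θ s| ≤ C1 * (L * M * ε) * (Real.exp s ^ 2 * min 1 (Real.exp s)) := by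
    intro s' hs' hb
    obtain ⟨hΦN, hΦr⟩ := hsmall s' hs' hb
    obtain ⟨q1, q2, q3⟩ := hq Φ Θ s' hs' hΦN (fun s _ => hΘN s) hΦr (fun s _ => hΘr' s)
    refine hlin (fun s => Φ s - Θ s) (fun s => Φ1 s - Θ1 s) (fun s => Φ2 s - Θ2 s) _
      (fun s => -(lam * (ε * Real.exp s ^ 2) - (ε * Real.exp s ^ 2) ^ 2) * Θ s) (L * M * ε) s'
      (by positivity) (fun x => (hΦ1 x).sub (hΘ1 x)) (fun x => (hΦ2 x).sub (hΘ2 x)) ?_ q1 q2 q3 ?_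
      hDO
    · intro s
      linear_combination hΦeq s - hΘeq s
    · intro s hs
      rw [abs_mul, abs_neg]
      calc _ ≤ L * (ε * Real.exp s ^ 2) * (M * min 1 (Real.exp s)) := by
            gcongr
            · exact hPb s (hs.trans hs')
            · exact hΘb s
        _ = _ := by ring
  have hcont : Continuous (fun s => |Φ s - Θ s| - δ * min 1 (Real.exp s)) := by
    have c1 : Continuous Φ := continuous_iff_continuousAt.2 fun x => (hΦ1 x).continuousAt
    have c2 : Continuous Θ := continuous_iff_continuousAt.2 fun x => (hΘ1 x).continuousAt
    fun_prop
  have hboot := bootstrap (s0 := s0) hcont (by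
      obtain ⟨C0, hC0, hOC⟩ := hDO.exists_pos
      have hz : Tendsto (fun s => C0 * Real.exp s ^ 2) atBot (𝓝 0) := by
        simpa using ((Real.tendsto_exp_atBot).pow 2).const_mul C0
      filter_upwards [hOC.bound, hz.eventually (gt_mem_nhds hδp), eventually_le_atBot 0]
        with s h1 h2 h3
      have hmin : min 1 (Real.exp s) = Real.exp s := min_eq_right (Real.exp_le_one_iff.mpr h3)
      rw [hmin]
      simp only [Real.norm_eq_abs, abs_pow, Real.abs_exp] at h1
      have := Real.exp_pos s
      nlinarith) (by
      intro s' hs' hb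
      have := hDest s' hs' (fun s hs => by linarith [hb s hs]) s' le_rfl
      have h1 := hmu s'
      have h2 := hy s' hs'
      have : |Φ s' - Θ s'| ≤ δ / 2 * min 1 (Real.exp s') := by
        calc _ ≤ _ := this
          _ = C1 * L * M * (ε * Real.exp s' ^ 2) * min 1 (Real.exp s') := by ring
          _ ≤ C1 * L * M * η0 * min 1 (Real.exp s') := by gcongr
          _ ≤ _ := by gcongr
      nlinarith)
  have hb : ∀ s ≤ s0, |Φ s - Θ s| ≤ δ * min 1 (Real.exp s) := fun s hs => by
    linarith [hboot s hs]
  have hDfin := hDest s0 le_rfl hb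
  obtain ⟨hΦN, hΦr⟩ := hsmall s0 le_rfl hb
  obtain ⟨q1, q2, q3⟩ := hq Φ Φ s0 le_rfl hΦN hΦN hΦr hΦr
  have hG := hlin (fun s => g s - Θ1 s) (fun s => g1 s - Θ2 s) (fun s => g2 s - Θ3 s) _
      (fun s => -((lam * (ε * Real.exp s ^ 2) - (ε * Real.exp s ^ 2) ^ 2) * Θ1 s
        + 3 * (Φ s + Θ s) * (Φ s - Θ s) * Θ1 s)) (L * M * (1 + 6 * N * C1 * M) * ε) s0
      (by positivity) (fun x => (hg1 x).sub (hΘ2 x)) (fun x => (hg2 x).sub (hΘ3 x))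
      (by intro s; linear_combination hgeq s - hΘeq' s) q1 q2 q3 (by
        intro s hs
        have h0 := hmu s
        have h01 := hmu1 s
        have t1 : |(lam * (ε * Real.exp s ^ 2) - (ε * Real.exp s ^ 2) ^ 2) * Θ1 s|
            ≤ L * (ε * Real.exp s ^ 2) * (M * min 1 (Real.exp s)) := by
          rw [abs_mul]
          gcongr
          · exact hPb s hs
          · exact hΘ1b s
        have t2 : |Φ s + Θ s| ≤ 2 * N := by
          calc _ ≤ |Φ s| + |Θ s| := abs_add_le _ _
            _ ≤ N * min 1 (Real.exp s) + N * min 1 (Real.exp s) := add_le_add (hΦN s hs) (hΘN s)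
            _ ≤ _ := by nlinarith
        have t3 : |Θ1 s| ≤ M := (hΘ1b s).trans (by nlinarith)
        have t4 : |3 * (Φ s + Θ s) * (Φ s - Θ s) * Θ1 s|
            ≤ 3 * (2 * N) * (C1 * (L * M * ε) * (Real.exp s ^ 2 * min 1 (Real.exp s))) * M := by
          rw [abs_mul, abs_mul, abs_mul, abs_of_pos (show (0:ℝ) < 3 by norm_num)]
          gcongr
          exact hDfin s hs
        rw [abs_neg]
        refine (abs_add_le _ _).trans ((add_le_add t1 t4).trans (le_of_eq ?_))
        ring) hGO s0 le_rfl
  refine hG.trans ?_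
  have h01 := hmu1 s0
  calc _ ≤ C1 * (L * M * (1 + 6 * N * C1 * M) * ε) * (Real.exp s0 ^ 2 * 1) := by gcongr
    _ = _ := by ring

set_option maxHeartbeats 1000000 in
lemma theta_top {D p m r A : ℝ} (hD : 13 ≤ D) (hpm : p + m = -(D-4))
    (hpm' : p * m = 2 * (D-3)) (hmp : m < p) (hp : p < -2) (hr : 0 ≤ r) (hr2 : r ^ 2 = D - 3)
    {Θ Θ1 Θ2 : ℝ → ℝ}
    (hΘ1 : ∀ x, HasDerivAt Θ (Θ1 x) x) (hΘ2 : ∀ x, HasDerivAt Θ1 (Θ2 x) x)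
    (hΘeq : ∀ s, Θ2 s + (D-4) * Θ1 s + (3-D) * Θ s + Θ s ^ 3 = 0)
    (htop : (fun t : ℝ => Θ t - r - A * Real.exp (p * t))
      =O[atTop] fun t : ℝ => Real.exp (m * t) + Real.exp (2 * p * t)) :
    ∃ C > 0, ∃ S ≥ 0, ∀ s ≥ S, |Θ s - r| ≤ C * Real.exp (p * s) ∧
      |Θ1 s - A * p * Real.exp (p * s)| ≤ C * (Real.exp (m * s) + Real.exp (2 * p * s)) ∧
      |Θ1 s| ≤ C := by
  obtain ⟨C0, hC0, hOC⟩ := htop.exists_pos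
  rw [IsBigOWith, eventually_atTop] at hOC
  obtain ⟨S0, hS0⟩ := hOC
  have hEp : ∀ s, 0 < Real.exp (m * s) + Real.exp (2 * p * s) := fun s => by positivity
  have hR : ∀ x ≥ S0, |Θ x - r - A * Real.exp (p * x)|
      ≤ C0 * (Real.exp (m * x) + Real.exp (2 * p * x)) := by
    intro x hx
    have := hS0 x hx
    rwa [Real.norm_eq_abs, Real.norm_eq_abs, abs_of_pos (hEp x)] at this
  have hE2 : ∀ x ≥ 0, Real.exp (m * x) + Real.exp (2 * p * x) ≤ 2 * Real.exp (p * x) := by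
    intro x hx
    have h1 : Real.exp (m * x) ≤ Real.exp (p * x) := Real.exp_le_exp.2 (by nlinarith)
    have h2 : Real.exp (2 * p * x) ≤ Real.exp (p * x) := Real.exp_le_exp.2 (by nlinarith)
    linarith
  set C3 := 2 * C0 + |A| with hC3
  have hC3p : 0 < C3 := by positivity
  have hy : ∀ x ≥ max S0 0, |Θ x - r| ≤ C3 * Real.exp (p * x) := by
    intro x hx
    have h1 := hR x ((le_max_left _ _).trans hx)
    have h2 := hE2 x ((le_max_right _ _).trans hx)
    calc |Θ x - r| = |(Θ x - r - A * Real.exp (p * x)) + A * Real.exp (p * x)| := by ring_nf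
      _ ≤ |Θ x - r - A * Real.exp (p * x)| + |A * Real.exp (p * x)| := abs_add_le _ _
      _ ≤ C0 * (2 * Real.exp (p * x)) + |A| * Real.exp (p * x) := by
          rw [abs_mul, Real.abs_exp]
          gcongr
          exact h1.trans (by gcongr)
      _ = _ := by rw [hC3]; ring
  set C4 := 2 * (D - 3) * C0 + (3 * r + C3) * C3 ^ 2 with hC4
  have hC4p : 0 < C4 := by
    have : 0 < D - 3 := by linarith
    positivity
  set B := Real.exp (-m) + Real.exp (-(2 * p)) with hB
  have hBp : 0 < B := by positivity
  set C5 := (3 + 2 * (D - 4)) * ((C0 + C4) * B) with hC5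
  have hC5p : 0 < C5 := by
    have : 0 < D - 4 := by linarith
    positivity
  have he1 : ∀ x ≥ 0, Real.exp (p * x) ≤ 1 := fun x hx =>
    Real.exp_le_one_iff.2 (by nlinarith)
  have hder : ∀ s ≥ max S0 0 + 1, |Θ1 s - A * p * Real.exp (p * s)|
      ≤ C5 * (Real.exp (m * s) + Real.exp (2 * p * s)) := by
    intro s hs
    have hexp : ∀ x, HasDerivAt (fun x => Real.exp (p * x)) (Real.exp (p * x) * p) x := by
      intro x
      simpa using ((hasDerivAt_id x).const_mul p).exp
    have hBE : ∀ x ∈ Icc (s-1) s, Real.exp (m * x) + Real.exp (2 * p * x)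
        ≤ B * (Real.exp (m * s) + Real.exp (2 * p * s)) := by
      intro x hx
      have h1 : Real.exp (m * x) ≤ Real.exp (-m) * Real.exp (m * s) := by
        rw [← Real.exp_add]; apply Real.exp_le_exp.2; nlinarith [hx.1]
      have h2 : Real.exp (2 * p * x) ≤ Real.exp (-(2 * p)) * Real.exp (2 * p * s) := by
        rw [← Real.exp_add]; apply Real.exp_le_exp.2; nlinarith [hx.1]
      have h3 : 0 < Real.exp (-m) * Real.exp (2 * p * s) := by positivity
      have h4 : 0 < Real.exp (-(2 * p)) * Real.exp (m * s) := by positivity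
      rw [hB]; nlinarith
    have := interp_deriv (U := fun x => Θ x - r - A * Real.exp (p * x))
      (U1 := fun x => Θ1 x - A * p * Real.exp (p * x))
      (U2 := fun x => Θ2 x - A * p ^ 2 * Real.exp (p * x)) (c := D - 4) (s := s)
      (ρ := (C0 + C4) * (B * (Real.exp (m * s) + Real.exp (2 * p * s)))) (by linarith)
      (fun x => (((hΘ1 x).sub_const r).sub ((hexp x).const_mul A)).congr_deriv (by ring))
      (fun x => ((hΘ2 x).sub ((hexp x).const_mul (A * p))).congr_deriv (by ring))
      (by
        intro x hx
        have hx1 : x ≥ S0 := by linarith [hx.1, le_max_left S0 0]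
        have := hEp x
        calc _ ≤ C0 * (Real.exp (m * x) + Real.exp (2 * p * x)) := hR x hx1
          _ ≤ (C0 + C4) * (Real.exp (m * x) + Real.exp (2 * p * x)) := by gcongr; linarith
          _ ≤ _ := by gcongr; exact hBE x hx)
      (by
        intro x hx
        have hx1 : x ≥ S0 := by linarith [hx.1, le_max_left S0 0]
        have hx0 : x ≥ 0 := by linarith [hx.1, le_max_right S0 0]
        have hxm : x ≥ max S0 0 := by linarith [hx.1]
        have hE := hEp x
        have hyx := hy x hxm
        have hRx := hR x hx1
        have hp2 : p ^ 2 + (D - 4) * p + 2 * (D - 3) = 0 := by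
          have : D - 4 = -(p + m) := by linarith
          rw [this, ← hpm']; ring
        have e : Θ2 x - A * p ^ 2 * Real.exp (p * x)
            + (D - 4) * (Θ1 x - A * p * Real.exp (p * x))
            = -(2 * (D - 3) * (Θ x - r - A * Real.exp (p * x))
              + (3 * r + (Θ x - r)) * (Θ x - r) ^ 2) := by
          linear_combination hΘeq x - A * Real.exp (p * x) * hp2 + (2 * r - 3 * Θ x) * hr2

        rw [e, abs_neg]
        have hy3 : |Θ x - r| ≤ C3 := hyx.trans (by have := he1 x hx0; nlinarith)
        have hys : |(Θ x - r) ^ 2| ≤ C3 ^ 2 * (Real.exp (m * x) + Real.exp (2 * p * x)) := by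
          rw [abs_pow]
          calc |Θ x - r| ^ 2 ≤ (C3 * Real.exp (p * x)) ^ 2 := by gcongr
            _ = C3 ^ 2 * Real.exp (2 * p * x) := by
                rw [mul_pow, ← Real.exp_nat_mul]; congr 2; push_cast; ring
            _ ≤ _ := by
                gcongr
                have := Real.exp_pos (m * x)
                linarith
        have hd3 : 0 < D - 3 := by linarith
        calc _ ≤ |2 * (D - 3) * (Θ x - r - A * Real.exp (p * x))|
              + |(3 * r + (Θ x - r)) * (Θ x - r) ^ 2| := abs_add_le _ _
          _ ≤ 2 * (D - 3) * (C0 * (Real.exp (m * x) + Real.exp (2 * p * x)))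
              + (3 * r + C3) * (C3 ^ 2 * (Real.exp (m * x) + Real.exp (2 * p * x))) := by
              rw [abs_mul, abs_mul (3 * r + (Θ x - r)), abs_of_pos (by linarith : 0 < 2 * (D - 3))]
              gcongr
              calc _ ≤ |3 * r| + |Θ x - r| := abs_add_le _ _
                _ ≤ _ := by rw [abs_of_nonneg (by positivity)]; gcongr
          _ = C4 * (Real.exp (m * x) + Real.exp (2 * p * x)) := by rw [hC4]; ring
          _ ≤ (C0 + C4) * (Real.exp (m * x) + Real.exp (2 * p * x)) := by gcongr; linarith
          _ ≤ _ := by gcongr; exact hBE x hx)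
    refine this.trans (le_of_eq ?_)
    rw [hC5]; ring
  refine ⟨C3 + 2 * C5 + |A * p|, by positivity, max S0 0 + 1,
    by linarith [le_max_right S0 0], ?_⟩
  intro s hs
  have hs0 : s ≥ 0 := by linarith [le_max_right S0 0]
  have hE := hEp s
  have hAp := abs_nonneg (A * p)
  have hd := hder s hs
  refine ⟨?_, ?_, ?_⟩
  · refine (hy s (by linarith)).trans ?_
    gcongr; linarith
  · refine hd.trans ?_
    gcongr; linarith
  · have h1 := he1 s hs0
    have h2 := hE2 s hs0
    have hep := Real.exp_pos (p * s)
    calc |Θ1 s| = |(Θ1 s - A * p * Real.exp (p * s)) + A * p * Real.exp (p * s)| := by ring_nf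
      _ ≤ |Θ1 s - A * p * Real.exp (p * s)| + |A * p * Real.exp (p * s)| := abs_add_le _ _
      _ ≤ C5 * (2 * 1) + |A * p| * 1 := by
          rw [abs_mul (A * p), Real.abs_exp]
          gcongr
          refine hd.trans ?_
          gcongr
          linarith
      _ ≤ _ := by linarith

lemma bounded_mu {F : ℝ → ℝ} (hc : Continuous F) (hbot : F =O[atBot] fun s => Real.exp s)
    {C S : ℝ} (htop : ∀ s ≥ S, |F s| ≤ C) : ∃ M : ℝ, ∀ s, |F s| ≤ M * min 1 (Real.exp s) := by
  obtain ⟨C1, hC1, hO⟩ := hbot.exists_pos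
  rw [IsBigOWith, eventually_atBot] at hO
  obtain ⟨s1, hs1⟩ := hO
  have hmu : ∀ s, 0 < min 1 (Real.exp s) := fun s => lt_min one_pos (Real.exp_pos s)
  have hcq : Continuous fun s => F s / min 1 (Real.exp s) := by
    apply hc.div (by fun_prop)
    intro s; exact (hmu s).ne'
  obtain ⟨C3, hC3⟩ := (isCompact_Icc (a := min s1 0) (b := max S 0)).exists_bound_of_continuousOn
    hcq.continuousOn
  refine ⟨C1 + |C| + |C3|, ?_⟩
  intro s
  have h0 := hmu s
  have n1 := abs_nonneg C
  have n3 := abs_nonneg C3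
  by_cases ha : s ≤ min s1 0
  · have hm : min 1 (Real.exp s) = Real.exp s :=
      min_eq_right (Real.exp_le_one_iff.2 (ha.trans (min_le_right _ _)))
    have := hs1 s (ha.trans (min_le_left _ _))
    rw [Real.norm_eq_abs, Real.norm_eq_abs, Real.abs_exp] at this
    rw [hm] at *
    refine this.trans ?_
    gcongr; linarith
  by_cases hb : max S 0 ≤ s
  · have hm : min 1 (Real.exp s) = 1 :=
      min_eq_left (Real.one_le_exp ((le_max_right _ _).trans hb))
    rw [hm]
    have := htop s ((le_max_left _ _).trans hb)
    have := le_abs_self C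
    linarith
  · push Not at ha hb
    have := hC3 s ⟨ha.le, hb.le⟩
    rw [Real.norm_eq_abs, abs_div, abs_of_pos h0, div_le_iff₀ h0] at this
    refine this.trans ?_
    gcongr
    have := le_abs_self C3
    linarith

lemma shift_asym {F : ℝ → ℝ} {b c : ℝ}
    (h : (fun t => F t - c * Real.exp t) =O[atBot] fun t => Real.exp t ^ 3) (hb : 0 < b) :
    (fun s => F (s - Real.log b) - c / b * Real.exp s) =O[atBot] fun s => Real.exp s ^ 3 := by
  have ht : Tendsto (fun s : ℝ => s - Real.log b) atBot atBot :=
    tendsto_atBot_add_const_right _ (-Real.log b) tendsto_id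
  have h1 := h.comp_tendsto ht
  have e : ∀ s, Real.exp (s - Real.log b) = Real.exp s / b := fun s => by
    rw [Real.exp_sub, Real.exp_log hb]
  refine (h1.congr_left ?_).trans ?_
  · intro s
    simp only [Function.comp, e]; ring
  · have : ((fun t => Real.exp t ^ 3) ∘ fun s : ℝ => s - Real.log b)
        = fun s => (b ^ 3)⁻¹ * Real.exp s ^ 3 := by
      funext s; simp only [Function.comp, e, div_pow]; field_simp
    rw [this]
    exact (isBigO_refl _ _).const_mul_left _

/-- Corollary 3.2 (Corollary `corollary-1` in the paper): under Assumption 1 on the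
heteroclinic orbit `Θ`, the representation of `γ_b = ∂_b Ψ_b` at `t = T + (a-1) log b`. -/
theorem stmt_3 (d : ℤ) (hd : 13 ≤ d) (lam : ℝ)
    (Θ : ℝ → ℝ) (Ψ γ : ℝ → ℝ → ℝ)
    (hΘC : ContDiff ℝ 2 Θ)
    (hΘeq : ∀ t : ℝ, deriv (deriv Θ) t + ((d : ℝ) - 4) * deriv Θ t
      + (3 - (d : ℝ)) * Θ t + (Θ t) ^ 3 = 0)
    (hΘasym : (fun t : ℝ => Θ t - Real.exp t + (2 * (d : ℝ))⁻¹ * Real.exp (3 * t))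
      =O[atBot] fun t : ℝ => Real.exp (5 * t))
    (hΘ'asym : (fun t : ℝ => deriv Θ t - Real.exp t) =O[atBot] fun t : ℝ => Real.exp (3 * t))
    (hΘ''asym : (fun t : ℝ => deriv (deriv Θ) t - Real.exp t)
      =O[atBot] fun t : ℝ => Real.exp (3 * t))
    (hΨC : ∀ b : ℝ, 0 < b → ContDiff ℝ 2 (Ψ b))
    (hΨeq : ∀ b : ℝ, 0 < b → ∀ t : ℝ,
      deriv (deriv (Ψ b)) t + ((d : ℝ) - 4) * deriv (Ψ b) t
        + (3 - (d : ℝ)) * Ψ b t + (Ψ b t) ^ 3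
        = -lam * Real.exp (2 * t) * Ψ b t + Real.exp (4 * t) * Ψ b t)
    (hΨasym : ∀ b : ℝ, 0 < b →
      (fun t : ℝ => Ψ b t - b * Real.exp t
          + (lam * b + b ^ 3) * (2 * (d : ℝ))⁻¹ * Real.exp (3 * t))
        =O[atBot] fun t : ℝ => Real.exp (5 * t))
    (hdiff : ∀ b : ℝ, 0 < b → ∀ t : ℝ, HasDerivAt (fun b' => Ψ b' t) (γ b t) b)
    (hγC : ∀ b : ℝ, 0 < b → ContDiff ℝ 2 (γ b))
    (hγeq : ∀ b : ℝ, 0 < b → ∀ t : ℝ,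
      deriv (deriv (γ b)) t + ((d : ℝ) - 4) * deriv (γ b) t + (3 - (d : ℝ)) * γ b t
        + 3 * (Ψ b t) ^ 2 * γ b t + lam * Real.exp (2 * t) * γ b t
        - Real.exp (4 * t) * γ b t = 0)
    (hγasym : ∀ b : ℝ, 0 < b →
      (fun t : ℝ => γ b t - Real.exp t) =O[atBot] fun t : ℝ => Real.exp (3 * t))
    (A₀ : ℝ) (hA₀ : A₀ ≠ 0)
    (hΘtop : (fun t : ℝ => Θ t - Real.sqrt ((d : ℝ) - 3) - A₀ * Real.exp (kappap d * t))
      =O[atTop] fun t : ℝ => Real.exp (kappam d * t) + Real.exp (2 * kappap d * t)) :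
    ∀ a ∈ Set.Ioo (0 : ℝ) (2 / (2 + |kappap d|)), ∀ T > (0 : ℝ),
      ∃ bTa > (0 : ℝ), ∃ CTa > (0 : ℝ), ∀ b > bTa,
        |γ b (T + (a - 1) * Real.log b)
            - A₀ * kappap d * b ^ (a * kappap d - 1) * Real.exp (kappap d * T)|
          ≤ CTa * max (b ^ (-2 * (1 - a) - 1))
              (max (b ^ (a * kappam d - 1)) (b ^ (2 * a * kappap d - 1))) := by
  intro a ha T hT
  obtain ⟨hpm, hpm', hmp, hp⟩ := kappa_facts d hd
  have hD : (13:ℝ) ≤ (d:ℝ) := by exact_mod_cast hd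
  set D : ℝ := (d:ℝ) with hDdef
  set p := kappap d with hpdef
  set m := kappam d with hmdef
  set r := Real.sqrt (D - 3) with hrdef
  have hr : 0 ≤ r := Real.sqrt_nonneg _
  have hr2 : r ^ 2 = D - 3 := Real.sq_sqrt (by linarith)
  have ha0 : 0 < a := ha.1
  have ha1 : a < 1 := by
    refine ha.2.trans_le ?_
    rw [div_le_one (by positivity)]
    linarith [abs_nonneg p]
  -- derivatives
  have der : ∀ F : ℝ → ℝ, ContDiff ℝ 2 F → (∀ x, HasDerivAt F (deriv F x) x) ∧
      (∀ x, HasDerivAt (deriv F) (deriv (deriv F) x) x) := by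
    intro F hF
    have h1 : ContDiff ℝ 1 (deriv F) := by
      have : ContDiff ℝ (1 + 1) F := by norm_num; exact hF
      exact (contDiff_succ_iff_deriv.1 this).2.2
    exact ⟨fun x => (hF.differentiable (by norm_num) x).hasDerivAt,
      fun x => (h1.differentiable (by norm_num) x).hasDerivAt⟩
  obtain ⟨dΘ1, dΘ2⟩ := der Θ hΘC
  have dΘ3 : ∀ x, HasDerivAt (deriv (deriv Θ)) (-((D-4) * deriv (deriv Θ) x
      + (3-D) * deriv Θ x + 3 * Θ x ^ 2 * deriv Θ x)) x := by
    intro x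
    have e : deriv (deriv Θ) = fun x => -((D-4) * deriv Θ x + (3-D) * Θ x + Θ x ^ 3) := by
      funext y; linarith [hΘeq y]
    have := ((((dΘ2 x).const_mul (D-4)).add ((dΘ1 x).const_mul (3-D))).add ((dΘ1 x).pow 3)).neg
    rw [e]
    refine (this.congr_deriv ?_).congr_of_eventuallyEq ?_
    · have := hΘeq x
      have e2 : deriv (deriv Θ) x = -((D-4) * deriv Θ x + (3-D) * Θ x + Θ x ^ 3) := by linarith
      simp only [← e2]
      push_cast
      ring
    · exact Eventually.of_forall fun y => rfl
  obtain ⟨Ct, hCt, St, hSt, htop⟩ := theta_top hD hpm hpm' hmp hp hr hr2 dΘ1 dΘ2 hΘeq hΘtop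
  -- bounds
  have e3 : ∀ t : ℝ, Real.exp (3 * t) = Real.exp t ^ 3 := fun t => by exact_mod_cast exp_mul_nat 3 t
  have e5 : ∀ t : ℝ, Real.exp (5 * t) = Real.exp t ^ 5 := fun t => by exact_mod_cast exp_mul_nat 5 t
  have hpow : ∀ k l : ℕ, l ≤ k → (fun t : ℝ => Real.exp t ^ k) =O[atBot] fun t => Real.exp t ^ l := by
    intro k l hkl
    refine IsBigO.of_bound 1 ?_
    filter_upwards [eventually_le_atBot 0] with t ht
    simp only [Real.norm_eq_abs, abs_pow, Real.abs_exp, one_mul]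
    exact pow_le_pow_of_le_one (Real.exp_pos t).le (Real.exp_le_one_iff.2 ht) hkl
  have h31 : (fun t : ℝ => Real.exp t ^ 3) =O[atBot] fun t => Real.exp t := by
    simpa using hpow 3 1 (by norm_num)
  have h53 := hpow 5 3 (by norm_num)
  simp only [e3, e5] at hΘasym hΘ'asym hΨasym hγasym
  have hΘ3 : (fun t => Θ t - Real.exp t) =O[atBot] fun t => Real.exp t ^ 3 := by
    refine ((hΘasym.trans h53).sub ((isBigO_refl (fun t : ℝ => Real.exp t ^ 3) atBot).const_mul_left
      ((2 * D)⁻¹))).congr_left ?_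
    intro t; ring
  have hΨ3 : ∀ b > 0, (fun t => Ψ b t - b * Real.exp t) =O[atBot] fun t => Real.exp t ^ 3 := by
    intro b hb
    refine (((hΨasym b hb).trans h53).sub
      ((isBigO_refl (fun t : ℝ => Real.exp t ^ 3) atBot).const_mul_left
      ((lam * b + b ^ 3) * (2 * D)⁻¹))).congr_left ?_
    intro t; ring
  have hΘO : Θ =O[atBot] fun t => Real.exp t := by
    refine ((hΘ3.trans h31).add (isBigO_refl (fun t : ℝ => Real.exp t) atBot)).congr_left ?_
    intro t; ring
  have hΘ1O : deriv Θ =O[atBot] fun t => Real.exp t := by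
    refine ((hΘ'asym.trans h31).add (isBigO_refl (fun t : ℝ => Real.exp t) atBot)).congr_left ?_
    intro t; ring
  have hexp1 : ∀ s ≥ St, Real.exp (p * s) ≤ 1 := fun s hs =>
    Real.exp_le_one_iff.2 (by nlinarith)
  obtain ⟨M1, hM1⟩ := bounded_mu hΘC.continuous hΘO (C := Ct + r) (S := St) (by
    intro s hs
    have h1 := (htop s hs).1
    have h2 := hexp1 s hs
    have h3 : |Θ s - r| ≤ Ct := h1.trans (by nlinarith)
    rw [abs_le] at *
    constructor <;> linarith)
  obtain ⟨M2, hM2⟩ := bounded_mu (F := deriv Θ)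
    (continuous_iff_continuousAt.2 fun x => (dΘ2 x).continuousAt) hΘ1O (C := Ct) (S := St)
    (fun s hs => (htop s hs).2.2)
  set M := 1 + r + |M1| + |M2| with hM
  have hmu : ∀ s, 0 < min 1 (Real.exp s) := fun s => lt_min one_pos (Real.exp_pos s)
  have n1 := abs_nonneg M1
  have n2 := abs_nonneg M2
  have hΘb : ∀ s, |Θ s| ≤ M * min 1 (Real.exp s) := fun s => (hM1 s).trans (by
    have := hmu s; have := le_abs_self M1; gcongr; linarith)
  have hΘ1b : ∀ s, |deriv Θ s| ≤ M * min 1 (Real.exp s) := fun s => (hM2 s).trans (by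
    have := hmu s; have := le_abs_self M2; gcongr; linarith)
  -- the threshold S2
  obtain ⟨S2, hS2, hΘr⟩ : ∃ S2 ≥ 0, ∀ s, S2 ≤ s → |Θ s - r| ≤ 1 / (24 * (M + 1)) := by
    have hlim : Tendsto (fun s => Ct * Real.exp (p * s)) atTop (𝓝 0) := by
      have : Tendsto (fun s : ℝ => p * s) atTop atBot :=
        tendsto_id.const_mul_atTop_of_neg (by linarith)
      simpa using (Real.tendsto_exp_atBot.comp this).const_mul Ct
    have hpos : 0 < 1 / (24 * (M + 1)) := by positivity
    obtain ⟨S, hS⟩ := eventually_atTop.1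
      ((hlim.eventually (gt_mem_nhds hpos)).and (eventually_ge_atTop St))
    exact ⟨max S 0, le_max_right _ _, fun s hs =>
      ((htop s (hS s ((le_max_left _ _).trans hs)).2).1).trans
        (hS s ((le_max_left _ _).trans hs)).1.le⟩
  obtain ⟨C, hC, η0, hη0, hpert⟩ := perturb (lam := lam) (M := M) hD hpm hpm' hmp hp hr hr2
    (by linarith) (by linarith) hS2 dΘ1 dΘ2 dΘ3 hΘeq (fun s => by ring) hΘb hΘ1b hΘr
  -- the choice of the threshold on b
  have hlog := Real.tendsto_log_atTop
  have hev : ∀ᶠ b : ℝ in atTop, 1 ≤ b ∧ Real.exp (2 * T - 2 * (1 - a) * Real.log b) ≤ η0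
      ∧ St ≤ T + a * Real.log b := by
    have t1 : Tendsto (fun b : ℝ => Real.exp (2 * T - 2 * (1 - a) * Real.log b)) atTop (𝓝 0) := by
      refine Real.tendsto_exp_atBot.comp ?_
      have : Tendsto (fun b : ℝ => (-(2 * (1 - a))) * Real.log b) atTop atBot :=
        hlog.const_mul_atTop_of_neg (by linarith)
      refine (tendsto_atBot_add_const_left _ (2 * T) this).congr ?_
      intro b; ring
    have t2 : Tendsto (fun b : ℝ => T + a * Real.log b) atTop atTop :=
      tendsto_atTop_add_const_left _ T (hlog.const_mul_atTop ha0)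
    filter_upwards [eventually_ge_atTop 1, t1.eventually (gt_mem_nhds hη0),
      t2.eventually (eventually_ge_atTop St)] with b h1 h2 h3
    exact ⟨h1, h2.le, h3⟩
  obtain ⟨b0, hb0⟩ := eventually_atTop.1 hev
  refine ⟨max b0 1, by positivity, C * Real.exp (2 * T) + 2 * Ct, by positivity, ?_⟩
  intro b hbgt
  obtain ⟨hb1, hbη, hbS⟩ := hb0 b ((le_max_left _ _).trans hbgt.le)
  have hb : 0 < b := by linarith
  set l := Real.log b with hl
  have hbe : Real.exp l = b := Real.exp_log hb
  set s0 := T + a * l with hs0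
  set ε := (b ^ 2)⁻¹ with hε
  have hεe : ε = Real.exp (-2 * l) := by
    rw [hε, ← hbe, ← Real.exp_nat_mul, ← Real.exp_neg]; congr 1; push_cast; ring
  have hεs : ε * Real.exp s0 ^ 2 = Real.exp (2 * T - 2 * (1 - a) * l) := by
    rw [hεe, ← Real.exp_nat_mul, ← Real.exp_add]; congr 1; rw [hs0]; push_cast; ring
  have hεx2 : ∀ s, Real.exp (2 * (s - l)) = ε * Real.exp s ^ 2 := by
    intro s
    rw [hεe, ← Real.exp_nat_mul, ← Real.exp_add]; congr 1; push_cast; ring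
  have hεx4 : ∀ s, Real.exp (4 * (s - l)) = (ε * Real.exp s ^ 2) ^ 2 := by
    intro s
    rw [← hεx2, ← Real.exp_nat_mul]; congr 1; push_cast; ring
  obtain ⟨dΨ1, dΨ2⟩ := der (Ψ b) (hΨC b hb)
  obtain ⟨dγ1, dγ2⟩ := der (γ b) (hγC b hb)
  have main := hpert ε s0 (fun s => Ψ b (s - l)) (fun s => deriv (Ψ b) (s - l))
    (fun s => deriv (deriv (Ψ b)) (s - l)) (fun s => b * γ b (s - l))
    (fun s => b * deriv (γ b) (s - l)) (fun s => b * deriv (deriv (γ b)) (s - l))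
    (by positivity) (inv_le_one_of_one_le₀ (one_le_pow₀ hb1)) (by rw [hεs]; exact hbη)
    (fun x => (dΨ1 (x - l)).comp_sub_const x l) (fun x => (dΨ2 (x - l)).comp_sub_const x l)
    (fun x => ((dγ1 (x - l)).comp_sub_const x l).const_mul b)
    (fun x => ((dγ2 (x - l)).comp_sub_const x l).const_mul b)
    (by
      intro s
      have := hΨeq b hb (s - l)
      rw [hεx2, hεx4] at this
      linear_combination this)
    (by
      intro s
      have := hγeq b hb (s - l)
      rw [hεx2, hεx4] at this
      linear_combination b * this)
    (by
      have h1 := shift_asym (hΨ3 b hb) hb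
      refine (h1.sub hΘ3).congr_left ?_
      intro s
      rw [div_self hb.ne']; ring)
    (by
      have h0 : (fun t => γ b t - 1 * Real.exp t) =O[atBot] fun t => Real.exp t ^ 3 := by
        simpa using hγasym b hb
      have h1 := (shift_asym h0 hb).const_mul_left b
      refine (h1.sub hΘ'asym).congr_left ?_
      intro s
      field_simp
      ring)
  have ht : T + (a - 1) * l = s0 - l := by rw [hs0]; ring
  rw [ht]
  have hrp : ∀ x : ℝ, b ^ x = Real.exp (l * x) := fun x => Real.rpow_def_of_pos hb x
  set X := max (b ^ (-2 * (1 - a) - 1)) (max (b ^ (a * m - 1)) (b ^ (2 * a * p - 1))) with hX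
  have x1 : b ^ (-2 * (1 - a) - 1) ≤ X := le_max_left _ _
  have x2 : b ^ (a * m - 1) ≤ X := (le_max_left _ _).trans (le_max_right _ _)
  have x3 : b ^ (2 * a * p - 1) ≤ X := (le_max_right _ _).trans (le_max_right _ _)
  have y1 : ε * Real.exp s0 ^ 2 = Real.exp (2 * T) * (b * b ^ (-2 * (1 - a) - 1)) := by
    rw [hεs, hrp]; nth_rewrite 1 [← hbe]
    rw [← Real.exp_add, ← Real.exp_add]; congr 1; ring
  have y2 : Real.exp (m * s0) ≤ b * b ^ (a * m - 1) := by
    rw [hrp]; nth_rewrite 1 [← hbe]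
    rw [← Real.exp_add]; apply Real.exp_le_exp.2; rw [hs0]; nlinarith
  have y3 : Real.exp (2 * p * s0) ≤ b * b ^ (2 * a * p - 1) := by
    rw [hrp]; nth_rewrite 1 [← hbe]
    rw [← Real.exp_add]; apply Real.exp_le_exp.2; rw [hs0]; nlinarith
  have y4 : b * (A₀ * p * b ^ (a * p - 1) * Real.exp (p * T)) = A₀ * p * Real.exp (p * s0) := by
    have : Real.exp (p * s0) = b * b ^ (a * p - 1) * Real.exp (p * T) := by
      rw [hrp]; nth_rewrite 1 [← hbe]
      rw [← Real.exp_add, ← Real.exp_add]; congr 1; rw [hs0]; ring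
    rw [this]; ring
  have htp := (htop s0 hbS).2.1
  have hfin : b * |γ b (s0 - l) - A₀ * p * b ^ (a * p - 1) * Real.exp (p * T)|
      ≤ b * ((C * Real.exp (2 * T) + 2 * Ct) * X) := by
    calc b * |γ b (s0 - l) - A₀ * p * b ^ (a * p - 1) * Real.exp (p * T)|
        = |b * (γ b (s0 - l) - A₀ * p * b ^ (a * p - 1) * Real.exp (p * T))| := by
          rw [abs_mul, abs_of_pos hb]
      _ = |(b * γ b (s0 - l) - deriv Θ s0) + (deriv Θ s0 - A₀ * p * Real.exp (p * s0))| := by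
          rw [mul_sub, y4]; congr 1; ring
      _ ≤ |b * γ b (s0 - l) - deriv Θ s0| + |deriv Θ s0 - A₀ * p * Real.exp (p * s0)| :=
          abs_add_le _ _
      _ ≤ C * (ε * Real.exp s0 ^ 2) + Ct * (Real.exp (m * s0) + Real.exp (2 * p * s0)) :=
          add_le_add main htp
      _ ≤ C * (Real.exp (2 * T) * (b * X)) + Ct * (b * X + b * X) := by
          rw [y1]
          gcongr
          · exact y2.trans (by gcongr)
          · exact y3.trans (by gcongr)
      _ = _ := by ring
  exact le_of_mul_le_mul_left hfin hb
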